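/- Hardy's omega results for the circle problem: (i) limsup_{x→∞} P(x)/x^{1/4} > 0; (ii) liminf_{x→∞} P(x)/x^{1/4} < 0; and moreover (iii) liminf_{x→∞} P(x)/(x^{1/4}(log x)^{1/4}) < 0. -/

import Mathlib

open Real Filter

/-- The number of integer lattice points in the closed origin-centered disc of radius `√x`. -/
noncomputable def latticeA (x : ℝ) : ℕ :=
  {p : ℤ × ℤ | (p.1 : ℝ) ^ 2 + (p.2 : ℝ) ^ 2 ≤ x}.ncard

/-- The lattice point discrepancy of the circle. -/
noncomputable def latticeP (x : ℝ) : ℝ := (latticeA x : ℝ) - Real.pi * x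

/-- The cosine transform of the semicircle density; it equals `π J₁(z) / z`. -/
noncomputable def semicircleCos (z : ℝ) : ℝ := ∫ x in (-1 : ℝ)..1, √(1 - x ^ 2) * cos (z * x)

/-- The analytic integrand whose real part on the real axis is that of `semicircleCos`. -/
noncomputable def semicircleExp (z : ℝ) (w : ℂ) : ℂ :=
  (1 - w ^ 2) ^ (2⁻¹ : ℂ) * Complex.exp (Complex.I * z * w)

lemma semicircleExp_differentiableAt (z : ℝ) {w : ℂ} (h1 : w.re ^ 2 < 1) :
    DifferentiableAt ℂ (semicircleExp z) w := by
  unfold semicircleExp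
  have : (1 - w ^ 2) ∈ Complex.slitPlane := by
    left
    simp [pow_two]
    nlinarith [sq_nonneg w.im]
  have h2 : DifferentiableAt ℂ (fun w : ℂ => 1 - w ^ 2) w := by fun_prop
  exact (h2.cpow (differentiableAt_const _) this).mul (by fun_prop)

lemma semicircleExp_continuousAt (z : ℝ) {w : ℂ} (h1 : w.re ^ 2 ≤ 1) :
    ContinuousAt (semicircleExp z) w := by
  unfold semicircleExp
  have h : ContinuousAt (fun u : ℂ => u ^ (2⁻¹ : ℂ)) (1 - w ^ 2) := by
    apply Complex.continuousAt_cpow_const_of_re_pos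
    · left
      simp [pow_two]
      nlinarith [sq_nonneg w.im]
    · norm_num
  have h2 : ContinuousAt (fun w : ℂ => (1 - w ^ 2)) w := by fun_prop
  exact (ContinuousAt.comp (f := fun w : ℂ => (1 - w ^ 2)) h h2).mul (by fun_prop)

lemma semicircleExp_ofReal_re (z : ℝ) {x : ℝ} (hx : x ^ 2 ≤ 1) :
    (semicircleExp z x).re = √(1 - x ^ 2) * cos (z * x) := by
  unfold semicircleExp
  have h1 : (1 - (x : ℂ) ^ 2) ^ (2⁻¹ : ℂ) = ((√(1 - x ^ 2) : ℝ) : ℂ) := by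
    rw [Real.sqrt_eq_rpow, Complex.ofReal_cpow (by linarith)]
    push_cast
    norm_num
  have h2 : Complex.I * z * x = ((z * x : ℝ) : ℂ) * Complex.I := by push_cast; ring
  rw [h1, Complex.re_ofReal_mul, h2, Complex.exp_ofReal_mul_I_re]

lemma semicircleExp_mul_I (z y : ℝ) :
    semicircleExp z (y * Complex.I) = ((√(1 + y ^ 2) * exp (-(z * y)) : ℝ) : ℂ) := by
  unfold semicircleExp
  have h0 : (1 - (y * Complex.I : ℂ) ^ 2) = ((1 + y ^ 2 : ℝ) : ℂ) := by
    rw [mul_pow, Complex.I_sq]; push_cast; ring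
  have h1 : (1 - (y * Complex.I : ℂ) ^ 2) ^ (2⁻¹ : ℂ) = ((√(1 + y ^ 2) : ℝ) : ℂ) := by
    rw [Real.sqrt_eq_rpow, Complex.ofReal_cpow (by positivity), h0]
    push_cast
    norm_num
  have h2 : Complex.I * z * (y * Complex.I) = ((-(z * y) : ℝ) : ℂ) := by
    push_cast
    linear_combination (z * y : ℂ) * Complex.I_sq
  rw [h1, h2]
  push_cast
  rfl

lemma semicircleExp_one_add_mul_I (z : ℝ) {y : ℝ} (hy : 0 ≤ y) :
    semicircleExp z (1 + y * Complex.I) = ((√y * exp (-(z * y)) : ℝ) : ℂ) *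
      ((y - 2 * Complex.I) ^ (2⁻¹ : ℂ) * Complex.exp (z * Complex.I)) := by
  unfold semicircleExp
  have h0 : (1 - (1 + y * Complex.I : ℂ) ^ 2) = y * (y - 2 * Complex.I) := by
    linear_combination -(y : ℂ) ^ 2 * Complex.I_sq
  have h1 : ((y : ℂ) * (y - 2 * Complex.I)) ^ (2⁻¹ : ℂ) =
      ((√y : ℝ) : ℂ) * (y - 2 * Complex.I) ^ (2⁻¹ : ℂ) := by
    rcases hy.eq_or_lt with rfl | hy
    · simp
    have hne : (y - 2 * Complex.I : ℂ) ≠ 0 := by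
      intro h
      have := congrArg Complex.im h
      simp at this
    have hy' : (y : ℂ) ≠ 0 := by exact_mod_cast hy.ne'
    rw [Complex.cpow_def_of_ne_zero (mul_ne_zero hy' hne), Complex.log_ofReal_mul hy hne, add_mul,
      Complex.exp_add, Complex.cpow_def_of_ne_zero hne, Real.sqrt_eq_rpow,
      Complex.ofReal_cpow hy.le, Complex.cpow_def_of_ne_zero hy', Complex.ofReal_log hy.le]
    norm_num
  have h2 : Complex.I * z * (1 + y * Complex.I) = z * Complex.I + ((-(z * y) : ℝ) : ℂ) := by
    push_cast
    linear_combination (z * y : ℂ) * Complex.I_sq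
  rw [h0, h1, h2, Complex.exp_add]
  push_cast
  ring

lemma norm_cpow_half_sub_le {y : ℝ} (hy : 0 ≤ y) :
    ‖((y : ℂ) - 2 * Complex.I) ^ (2⁻¹ : ℂ) - (1 - Complex.I)‖ ≤ y := by
  set c := ((y : ℂ) - 2 * Complex.I) ^ (2⁻¹ : ℂ) with hc
  have hsq : c ^ 2 = y - 2 * Complex.I := by
    rw [hc]
    exact_mod_cast Complex.cpow_nat_inv_pow _ two_ne_zero
  have hre : 0 ≤ c.re := by
    rw [hc, Complex.cpow_inv_two_re]; positivity
  have h1 : (c - (1 - Complex.I)) * (c + (1 - Complex.I)) = y := by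
    linear_combination hsq - Complex.I_sq
  have h2 : 1 ≤ ‖c + (1 - Complex.I)‖ := by
    refine le_trans ?_ (Complex.re_le_norm _)
    simp [hre]
  have h3 := congrArg norm h1
  rw [norm_mul, Complex.norm_real, Real.norm_of_nonneg hy] at h3
  nlinarith [norm_nonneg (c - (1 - Complex.I))]

lemma norm_semicircleExp_le {z x H : ℝ} (hx0 : 0 ≤ x) (hx : x ≤ 1) (hH : 0 ≤ H) :
    ‖semicircleExp z (x + H * Complex.I)‖ ≤ (3 + H) * exp (-(z * H)) := by
  unfold semicircleExp
  rw [norm_mul, Complex.norm_exp]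
  have h1 : (Complex.I * z * (x + H * Complex.I)).re = -(z * H) := by simp
  rw [h1]
  gcongr
  set c := (1 - ((x : ℂ) + H * Complex.I) ^ 2) ^ (2⁻¹ : ℂ) with hc
  have hsq : c ^ 2 = 1 - ((x : ℂ) + H * Complex.I) ^ 2 := by
    rw [hc]
    exact_mod_cast Complex.cpow_nat_inv_pow _ two_ne_zero
  have h2 : ‖(x : ℂ) + H * Complex.I‖ ≤ 1 + H := by
    refine (norm_add_le _ _).trans ?_
    simp [abs_of_nonneg hx0, abs_of_nonneg hH, hx]
  have h3 : ‖c‖ ^ 2 ≤ 1 + (1 + H) ^ 2 := by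
    rw [← norm_pow, hsq]
    refine (norm_sub_le _ _).trans ?_
    rw [norm_pow, norm_one]
    gcongr
  nlinarith [norm_nonneg c]

lemma semicircleCos_eq (z : ℝ) :
    semicircleCos z = 2 * ∫ x in (0 : ℝ)..1, √(1 - x ^ 2) * cos (z * x) := by
  unfold semicircleCos
  have hi : ∀ a b : ℝ, IntervalIntegrable (fun x : ℝ => √(1 - x ^ 2) * cos (z * x))
      MeasureTheory.volume a b := fun a b => Continuous.intervalIntegrable (by fun_prop) _ _
  rw [← intervalIntegral.integral_add_adjacent_intervals (hi (-1) 0) (hi 0 1), two_mul]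
  congr 1
  have := intervalIntegral.integral_comp_neg (a := 0) (b := 1)
    (fun x : ℝ => √(1 - x ^ 2) * cos (z * x))
  simp only [neg_zero] at this
  rw [← this]
  simp

lemma semicircleCos_approx_aux {z H : ℝ} (hH : 0 < H) :
    |semicircleCos z / 2 + (cos z - sin z) * ∫ y in (0 : ℝ)..H, √y * exp (-(z * y))| ≤
      (3 + H) * exp (-(z * H)) + ∫ y in (0 : ℝ)..H, √y * exp (-(z * y)) * y := by
  have hcont : ∀ w ∈ Set.uIcc (0 : ℝ) 1 ×ℂ Set.uIcc 0 H, ContinuousAt (semicircleExp z) w := by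
    intro w hw
    rw [Complex.mem_reProdIm, Set.uIcc_of_le zero_le_one] at hw
    exact semicircleExp_continuousAt z (by nlinarith [hw.1.1, hw.1.2])
  have key := Complex.integral_boundary_rect_eq_zero_of_continuousOn_of_differentiableOn
    (semicircleExp z) 0 ⟨1, H⟩ (fun w hw => (hcont w hw).continuousWithinAt) (by
      intro w hw
      rw [Complex.mem_reProdIm] at hw
      simp only [Complex.zero_re, zero_le_one, inf_of_le_left, sup_of_le_right] at hw
      exact (semicircleExp_differentiableAt z
        (by nlinarith [hw.1.1, hw.1.2])).differentiableWithinAt)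
  simp only [Complex.zero_re, Complex.zero_im, Complex.ofReal_zero, zero_mul, add_zero, zero_add,
    smul_eq_mul, Complex.ofReal_one] at key
  have hi1 : ContinuousOn (fun x : ℝ => semicircleExp z x) (Set.uIcc 0 1) := by
    intro x hx
    refine (ContinuousAt.comp (f := fun x : ℝ => (x : ℂ)) (hcont x ?_)
      (by fun_prop)).continuousWithinAt
    rw [Complex.mem_reProdIm]; simpa [hH.le] using hx
  have hi2 : ContinuousOn (fun y : ℝ => semicircleExp z (1 + y * Complex.I)) (Set.uIcc 0 H) := by
    intro x hx
    refine (ContinuousAt.comp (f := fun x : ℝ => (1 + x * Complex.I : ℂ)) (hcont _ ?_)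
      (by fun_prop)).continuousWithinAt
    rw [Complex.mem_reProdIm]; simpa using hx
  have e1 : (∫ x in (0 : ℝ)..1, semicircleExp z x).re = semicircleCos z / 2 := by
    rw [semicircleCos_eq, ← Complex.reCLM_apply,
      ← ContinuousLinearMap.intervalIntegral_comp_comm _ hi1.intervalIntegrable]
    rw [mul_div_cancel_left₀ _ two_ne_zero]
    refine intervalIntegral.integral_congr fun x hx => ?_
    rw [Set.uIcc_of_le zero_le_one] at hx
    exact semicircleExp_ofReal_re z (by nlinarith [hx.1, hx.2])
  have e2 : (Complex.I * ∫ y in (0 : ℝ)..H, semicircleExp z (y * Complex.I)).re = 0 := by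
    simp_rw [semicircleExp_mul_I, intervalIntegral.integral_ofReal]
    simp
  have e3 : ‖∫ x in (0 : ℝ)..1, semicircleExp z (x + H * Complex.I)‖ ≤
      (3 + H) * exp (-(z * H)) := by
    have := intervalIntegral.norm_integral_le_of_norm_le_const (a := (0 : ℝ)) (b := 1)
      (f := fun x : ℝ => semicircleExp z (x + H * Complex.I)) (C := (3 + H) * exp (-(z * H))) (by
        intro x hx
        rw [Set.uIoc_of_le zero_le_one] at hx
        exact norm_semicircleExp_le hx.1.le hx.2 hH.le)
    simpa using this
  have hr : ∀ g : ℝ → ℝ, g = (fun y => √y * exp (-(z * y))) →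
      ‖(∫ y in (0 : ℝ)..H, semicircleExp z (1 + y * Complex.I)) -
        (1 - Complex.I) * Complex.exp (z * Complex.I) * ((∫ y in (0 : ℝ)..H, g y : ℝ) : ℂ)‖ ≤
      ∫ y in (0 : ℝ)..H, g y * y := by
    intro g hg
    have hgc : Continuous g := by rw [hg]; fun_prop
    rw [← intervalIntegral.integral_ofReal, ← intervalIntegral.integral_const_mul,
      ← intervalIntegral.integral_sub hi2.intervalIntegrable
        (Continuous.intervalIntegrable (by fun_prop) _ _)]
    refine intervalIntegral.norm_integral_le_of_norm_le hH.le ?_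
      (Continuous.intervalIntegrable (by fun_prop) _ _)
    refine MeasureTheory.ae_of_all _ fun y hy => ?_
    rw [semicircleExp_one_add_mul_I z hy.1.le]
    have h0 : 0 ≤ g y := by rw [hg]; positivity
    have : ((√y * exp (-(z * y)) : ℝ) : ℂ) *
      ((y - 2 * Complex.I) ^ (2⁻¹ : ℂ) * Complex.exp (z * Complex.I)) -
      (1 - Complex.I) * Complex.exp (z * Complex.I) * (g y : ℂ) =
      (g y : ℂ) * (((y - 2 * Complex.I) ^ (2⁻¹ : ℂ) - (1 - Complex.I)) *
        Complex.exp (z * Complex.I)) := by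
      rw [hg]; ring
    rw [this, norm_mul, norm_mul, Complex.norm_exp_ofReal_mul_I, mul_one, Complex.norm_real,
      Real.norm_of_nonneg h0]
    exact mul_le_mul_of_nonneg_left (norm_cpow_half_sub_le hy.1.le) h0
  have hr := hr _ rfl
  set R := ∫ y in (0 : ℝ)..H, semicircleExp z (1 + y * Complex.I)
  set S := ∫ x in (0 : ℝ)..1, semicircleExp z (x + H * Complex.I)
  set G := ∫ y in (0 : ℝ)..H, √y * exp (-(z * y))
  have e4 : semicircleCos z / 2 + (cos z - sin z) * G =
      (S - Complex.I * (R - (1 - Complex.I) * Complex.exp (z * Complex.I) * (G : ℂ))).re := by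
    have h := congrArg Complex.re key
    rw [Complex.sub_re, Complex.add_re, Complex.sub_re, e1, e2, Complex.zero_re] at h
    have h5 : (Complex.I * ((1 - Complex.I) * Complex.exp (z * Complex.I) * (G : ℂ))).re =
        (cos z - sin z) * G := by
      rw [Complex.exp_mul_I, ← Complex.ofReal_cos, ← Complex.ofReal_sin]
      simp [-Complex.ofReal_cos, -Complex.ofReal_sin]
      ring
    rw [mul_sub, Complex.sub_re, Complex.sub_re, h5]
    linarith
  rw [e4]
  refine (Complex.abs_re_le_norm _).trans ((norm_sub_le _ _).trans ?_)
  rw [norm_mul, Complex.norm_I, one_mul]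
  exact add_le_add e3 hr

/-- The leading asymptotics of the Bessel function `J₁`. -/
lemma exists_semicircleCos_approx : ∃ C : ℝ, 0 < C ∧ ∀ z : ℝ, 0 < z →
    |semicircleCos z + √(2 * π) * z ^ (-(3 / 2) : ℝ) * cos (z + π / 4)| ≤
      C * z ^ (-(5 / 2) : ℝ) := by
  refine ⟨2 * Gamma (5 / 2), mul_pos two_pos (Gamma_pos_of_pos (by norm_num)), fun z hz => ?_⟩
  have hint : ∀ s : ℝ, 0 < s → MeasureTheory.IntegrableOn
      (fun t : ℝ => t ^ (s - 1) * exp (-(z * t))) (Set.Ioi 0) := by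
    intro s hs
    refine MeasureTheory.Integrable.of_integral_ne_zero ?_
    rw [Real.integral_rpow_mul_exp_neg_mul_Ioi hs hz]
    have := Gamma_pos_of_pos hs
    positivity
  have lim : ∀ s : ℝ, 0 < s → Tendsto (fun H : ℝ => ∫ t in (0 : ℝ)..H, t ^ (s - 1) * exp (-(z * t)))
      atTop (nhds ((1 / z) ^ s * Gamma s)) := by
    intro s hs
    rw [← Real.integral_rpow_mul_exp_neg_mul_Ioi hs hz]
    exact MeasureTheory.intervalIntegral_tendsto_integral_Ioi 0 (hint s hs) tendsto_id
  have l1 := lim (3 / 2) (by norm_num)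
  have l2 := lim (5 / 2) (by norm_num)
  have l3 : Tendsto (fun H : ℝ => (3 + H) * exp (-(z * H))) atTop (nhds 0) := by
    have a := (Real.tendsto_pow_mul_exp_neg_atTop_nhds_zero 0)
    have b := (Real.tendsto_pow_mul_exp_neg_atTop_nhds_zero 1)
    have hz' : Tendsto (fun H : ℝ => z * H) atTop atTop := tendsto_id.const_mul_atTop hz
    have := ((a.comp hz').const_mul 3).add ((b.comp hz').const_mul (1 / z))
    simp only [mul_zero, add_zero] at this
    refine this.congr fun H => ?_
    simp
    field_simp
  have hle : |semicircleCos z / 2 + (cos z - sin z) * ((1 / z) ^ (3 / 2 : ℝ) * Gamma (3 / 2))| ≤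
      0 + (1 / z) ^ (5 / 2 : ℝ) * Gamma (5 / 2) := by
    refine le_of_tendsto_of_tendsto ((l1.const_mul (cos z - sin z)).const_add _).abs
      (l3.add l2) ?_
    filter_upwards [eventually_gt_atTop 0] with H hH
    have h := semicircleCos_approx_aux (z := z) hH
    have i1 : ∫ t in (0 : ℝ)..H, t ^ (3 / 2 - 1 : ℝ) * exp (-(z * t)) =
        ∫ y in (0 : ℝ)..H, √y * exp (-(z * y)) := by
      refine intervalIntegral.integral_congr fun t _ => ?_
      simp only [Real.sqrt_eq_rpow]
      norm_num
    have i2 : ∫ t in (0 : ℝ)..H, t ^ (5 / 2 - 1 : ℝ) * exp (-(z * t)) =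
        ∫ y in (0 : ℝ)..H, √y * exp (-(z * y)) * y := by
      refine intervalIntegral.integral_congr fun t ht => ?_
      rw [Set.uIcc_of_le hH.le] at ht
      have : t ^ (5 / 2 - 1 : ℝ) = √t * t := by
        rw [Real.sqrt_eq_rpow, ← Real.rpow_add_one' ht.1 (by norm_num)]
        norm_num
      simp only [this]
      ring
    rw [i1, i2]
    exact h
  have hG : Gamma (3 / 2) = √π / 2 := by
    have := Real.Gamma_add_one (s := 1 / 2) (by norm_num)
    rw [Real.Gamma_one_half_eq] at this
    norm_num at this
    rw [this]; ring
  have hc : √(2 * π) * cos (z + π / 4) = √π * (cos z - sin z) := by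
    rw [cos_add, cos_pi_div_four, sin_pi_div_four, Real.sqrt_mul (by norm_num)]
    linear_combination (√π * (cos z - sin z) / 2) *
      Real.mul_self_sqrt (show (0 : ℝ) ≤ 2 by norm_num)
  have hp : ∀ s : ℝ, (1 / z) ^ s = z ^ (-s) := fun s => by
    rw [one_div, Real.inv_rpow hz.le, Real.rpow_neg hz.le]
  rw [hG, hp, hp] at hle
  have : semicircleCos z + √(2 * π) * z ^ (-(3 / 2) : ℝ) * cos (z + π / 4) =
      2 * (semicircleCos z / 2 + (cos z - sin z) * (z ^ (-(3 / 2) : ℝ) * (√π / 2))) := by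
    linear_combination z ^ (-(3 / 2) : ℝ) * hc
  rw [this, abs_mul, abs_two]
  linarith

lemma setIntegral_closedBall_circle_mul (u : Circle) (T : ℝ) (k : ℂ → ℝ) :
    ∫ w in Metric.closedBall (0 : ℂ) T, k (u * w) = ∫ w in Metric.closedBall (0 : ℂ) T, k w := by
  have h := (LinearIsometryEquiv.measurePreserving (rotation u)).setIntegral_preimage_emb
    (rotation u).toHomeomorph.measurableEmbedding k (Metric.closedBall 0 T)
  have hs : (rotation u) ⁻¹' Metric.closedBall 0 T = Metric.closedBall 0 T := by
    rw [LinearIsometryEquiv.preimage_closedBall, map_zero]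
  rw [hs] at h
  simpa only [rotation_apply] using h

lemma setIntegral_closedBall_eq {T : ℝ} (hT : 0 ≤ T) {k : ℂ → ℝ} (hk : Continuous k) :
    ∫ w in Metric.closedBall (0 : ℂ) T, k w =
      ∫ y in (-T)..T, ∫ x in (-√(T ^ 2 - y ^ 2))..√(T ^ 2 - y ^ 2), k ⟨x, y⟩ := by
  have hmem : ∀ x y : ℝ, (⟨x, y⟩ : ℂ) ∈ Metric.closedBall (0 : ℂ) T ↔ x ^ 2 + y ^ 2 ≤ T ^ 2 := by
    intro x y
    rw [mem_closedBall_zero_iff, ← sq_le_sq₀ (norm_nonneg _) hT, ← Complex.normSq_eq_norm_sq,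
      Complex.normSq_mk, pow_two x, pow_two y]
  have hint : MeasureTheory.Integrable ((Metric.closedBall (0 : ℂ) T).indicator k) :=
    (MeasureTheory.integrable_indicator_iff measurableSet_closedBall).2
      (hk.continuousOn.integrableOn_compact (isCompact_closedBall _ _))
  have hp := Complex.volume_preserving_equiv_real_prod.symm
  rw [← MeasureTheory.integral_indicator measurableSet_closedBall,
    ← hp.integral_comp Complex.measurableEquivRealProd.symm.measurableEmbedding,
    MeasureTheory.Measure.volume_eq_prod, MeasureTheory.integral_prod_symm
      (fun p => (Metric.closedBall (0 : ℂ) T).indicator k (Complex.measurableEquivRealProd.symm p))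
      ((hp.integrable_comp_emb Complex.measurableEquivRealProd.symm.measurableEmbedding).2 hint),
    intervalIntegral.integral_of_le (by linarith), ← MeasureTheory.integral_Icc_eq_integral_Ioc,
    ← MeasureTheory.integral_indicator measurableSet_Icc]
  refine MeasureTheory.integral_congr_ae (MeasureTheory.ae_of_all _ fun y => ?_)
  have he : ∀ x : ℝ, Complex.measurableEquivRealProd.symm (x, y) = ⟨x, y⟩ := fun x => rfl
  simp only [he]
  by_cases hy : y ∈ Set.Icc (-T) T
  · rw [Set.indicator_of_mem hy,
      intervalIntegral.integral_of_le (by linarith [Real.sqrt_nonneg (T ^ 2 - y ^ 2)]),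
      ← MeasureTheory.integral_Icc_eq_integral_Ioc,
      ← MeasureTheory.integral_indicator measurableSet_Icc]
    refine MeasureTheory.integral_congr_ae (MeasureTheory.ae_of_all _ fun x => ?_)
    have : (⟨x, y⟩ : ℂ) ∈ Metric.closedBall (0 : ℂ) T ↔
        x ∈ Set.Icc (-√(T ^ 2 - y ^ 2)) √(T ^ 2 - y ^ 2) := by
      rw [hmem, Set.mem_Icc, ← abs_le, ← Real.sqrt_sq_eq_abs,
        Real.sqrt_le_sqrt_iff (by nlinarith [hy.1, hy.2])]
      constructor <;> intro h <;> linarith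
    simp only [Set.indicator, this]
  · rw [Set.indicator_of_notMem hy]
    refine MeasureTheory.integral_eq_zero_of_ae (MeasureTheory.ae_of_all _ fun x => ?_)
    refine Set.indicator_of_notMem (fun h => hy ?_) _
    rw [hmem] at h
    exact abs_le.1 (abs_le_of_sq_le_sq (by nlinarith [sq_nonneg x]) hT)

/-- The Fourier transform of the indicator function of a centred disc. -/
lemma setIntegral_closedBall_cos {T : ℝ} (hT : 0 < T) (ξ : ℂ) :
    ∫ w in Metric.closedBall (0 : ℂ) T, cos (2 * π * (ξ.re * w.re + ξ.im * w.im)) =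
      2 * T ^ 2 * semicircleCos (2 * π * ‖ξ‖ * T) := by
  rw [← setIntegral_closedBall_circle_mul (Circle.exp (Complex.arg ξ - π / 2))]
  have hre : ∀ w : ℂ, ξ.re * ((Circle.exp (Complex.arg ξ - π / 2) : ℂ) * w).re +
      ξ.im * ((Circle.exp (Complex.arg ξ - π / 2) : ℂ) * w).im = ‖ξ‖ * w.im := by
    intro w
    rw [Circle.coe_exp, ← Complex.norm_mul_cos_arg, ← Complex.norm_mul_sin_arg]
    simp only [Complex.mul_re, Complex.mul_im, Complex.exp_ofReal_mul_I_re,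
      Complex.exp_ofReal_mul_I_im, cos_sub, sin_sub, cos_pi_div_two, sin_pi_div_two]
    linear_combination (‖ξ‖ * w.im) * Real.sin_sq_add_cos_sq (Complex.arg ξ)
  simp_rw [hre]
  rw [setIntegral_closedBall_eq hT.le (by fun_prop)]
  simp only [intervalIntegral.integral_const, smul_eq_mul]
  have h := intervalIntegral.integral_comp_mul_left (a := -1) (b := 1)
    (fun y : ℝ => (√(T ^ 2 - y ^ 2) - -√(T ^ 2 - y ^ 2)) * cos (2 * π * (‖ξ‖ * y))) hT.ne'
  simp only [mul_neg, mul_one, smul_eq_mul] at h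
  rw [inv_mul_eq_div, eq_div_iff hT.ne'] at h
  rw [← h, semicircleCos, ← intervalIntegral.integral_mul_const,
    ← intervalIntegral.integral_const_mul]
  refine intervalIntegral.integral_congr fun x _ => ?_
  have hs : √(T ^ 2 - (T * x) ^ 2) = T * √(1 - x ^ 2) := by
    rw [show T ^ 2 - (T * x) ^ 2 = T ^ 2 * (1 - x ^ 2) by ring, Real.sqrt_mul (sq_nonneg T),
      Real.sqrt_sq hT.le]
  have hx : 2 * π * (‖ξ‖ * (T * x)) = 2 * π * ‖ξ‖ * T * x := by ring
  simp only [hs, hx]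
  ring

/-- The Gaussian mollification of the indicator function of the centred disc of radius `T`. -/
noncomputable def smoothDisc (a T : ℝ) (z : ℂ) : ℝ :=
  ∫ w in Metric.closedBall (0 : ℂ) T, a * exp (-π * a * ‖z - w‖ ^ 2)

lemma smoothDisc_eq_norm (a T : ℝ) (z : ℂ) : smoothDisc a T z = smoothDisc a T (‖z‖ : ℂ) := by
  unfold smoothDisc
  rw [← setIntegral_closedBall_circle_mul (Circle.exp (Complex.arg z))]
  have : ∀ w : ℂ, ‖z - (Circle.exp (Complex.arg z) : ℂ) * w‖ = ‖(‖z‖ : ℂ) - w‖ := by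
    intro w
    have hz : z = (Circle.exp (Complex.arg z) : ℂ) * (‖z‖ : ℂ) := by
      rw [Circle.coe_exp, mul_comm]; exact (Complex.norm_mul_exp_arg_mul_I z).symm
    nth_rewrite 1 [hz]
    rw [← mul_sub, norm_mul, Circle.norm_coe, one_mul]
  simp_rw [this]

lemma smoothDisc_nonneg {a : ℝ} (ha : 0 ≤ a) (T : ℝ) (z : ℂ) : 0 ≤ smoothDisc a T z :=
  MeasureTheory.integral_nonneg fun _ => by positivity

lemma intervalIntegral_shift_antitone {g : ℝ → ℝ} (hg : Continuous g)
    (hanti : ∀ x y : ℝ, |x| ≤ |y| → g y ≤ g x) {h : ℝ} (hh : 0 ≤ h) {r s : ℝ} (hr : 0 ≤ r)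
    (hrs : r ≤ s) : ∫ x in (-h)..h, g (s - x) ≤ ∫ x in (-h)..h, g (r - x) := by
  have hi : ∀ a b : ℝ, IntervalIntegrable g MeasureTheory.volume a b :=
    fun a b => hg.intervalIntegrable a b
  rw [intervalIntegral.integral_comp_sub_left, intervalIntegral.integral_comp_sub_left]
  simp only [sub_neg_eq_add]
  have e1 := intervalIntegral.integral_add_adjacent_intervals (hi (r - h) (s - h))
    (hi (s - h) (s + h))
  have e2 := intervalIntegral.integral_add_adjacent_intervals (hi (r - h) (r + h))
    (hi (r + h) (s + h))
  have e3 : ∫ x in (r + h)..(s + h), g x ≤ ∫ x in (r - h)..(s - h), g x := by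
    rw [← intervalIntegral.integral_comp_add_right, ← intervalIntegral.integral_comp_sub_right]
    refine intervalIntegral.integral_mono_on hrs
      (Continuous.intervalIntegrable (by fun_prop) _ _)
      (Continuous.intervalIntegrable (by fun_prop) _ _) fun x hx => hanti _ _ ?_
    rw [abs_le, abs_of_nonneg (by linarith [hx.1])]
    constructor <;> linarith [hx.1]
  linarith

lemma smoothDisc_antitone {a : ℝ} (ha : 0 < a) {T : ℝ} (hT : 0 ≤ T) {r s : ℝ} (hr : 0 ≤ r)
    (hrs : r ≤ s) : smoothDisc a T (s : ℂ) ≤ smoothDisc a T (r : ℂ) := by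
  have hsq : ∀ t x y : ℝ, a * exp (-π * a * ‖(t : ℂ) - ⟨x, y⟩‖ ^ 2) =
      a * exp (-π * a * y ^ 2) * exp (-π * a * (t - x) ^ 2) := by
    intro t x y
    rw [← Complex.normSq_eq_norm_sq, Complex.normSq_apply, mul_assoc a, ← Real.exp_add]
    congr 2
    simp
    ring
  unfold smoothDisc
  rw [setIntegral_closedBall_eq hT (by fun_prop), setIntegral_closedBall_eq hT (by fun_prop)]
  simp_rw [hsq, intervalIntegral.integral_const_mul]
  have hcont : ∀ t : ℝ, Continuous fun y : ℝ => a * exp (-π * a * y ^ 2) *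
      ∫ x in (-√(T ^ 2 - y ^ 2))..√(T ^ 2 - y ^ 2), exp (-π * a * (t - x) ^ 2) := by
    intro t
    have hi : ∀ u v : ℝ, IntervalIntegrable (fun x : ℝ => exp (-π * a * (t - x) ^ 2))
        MeasureTheory.volume u v := fun u v => Continuous.intervalIntegrable (by fun_prop) _ _
    have hc : Continuous fun u : ℝ => ∫ x in (0 : ℝ)..u, exp (-π * a * (t - x) ^ 2) :=
      intervalIntegral.continuous_primitive hi 0
    have : ∀ y : ℝ, ∫ x in (-√(T ^ 2 - y ^ 2))..√(T ^ 2 - y ^ 2), exp (-π * a * (t - x) ^ 2) =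
        (∫ x in (0 : ℝ)..√(T ^ 2 - y ^ 2), exp (-π * a * (t - x) ^ 2)) -
          ∫ x in (0 : ℝ)..(-√(T ^ 2 - y ^ 2)), exp (-π * a * (t - x) ^ 2) := fun y =>
      (intervalIntegral.integral_interval_sub_left (hi _ _) (hi _ _)).symm
    simp_rw [this]
    have h1 : Continuous fun y : ℝ => √(T ^ 2 - y ^ 2) := by fun_prop
    exact (by fun_prop : Continuous fun y : ℝ => a * exp (-π * a * y ^ 2)).mul
      ((hc.comp h1).sub (hc.comp h1.neg))
  refine intervalIntegral.integral_mono_on (by linarith) ((hcont s).intervalIntegrable _ _)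
    ((hcont r).intervalIntegrable _ _) fun y _ => ?_
  refine mul_le_mul_of_nonneg_left ?_ (by positivity)
  refine intervalIntegral_shift_antitone (g := fun x => exp (-π * a * x ^ 2)) (by fun_prop) ?_
    (Real.sqrt_nonneg _) hr hrs
  intro x y hxy
  have := sq_le_sq.2 hxy
  have hp : 0 < π * a := by positivity
  exact Real.exp_le_exp.2 (by nlinarith)

/-- The lattice point `(m, k)` as the Gaussian integer `m + ki`. -/
def latticePoint (m : ℤ × ℤ) : ℂ := ⟨m.1, m.2⟩

lemma norm_latticePoint_sq (m : ℤ × ℤ) : ‖latticePoint m‖ ^ 2 = (m.1 : ℝ) ^ 2 + (m.2 : ℝ) ^ 2 := by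
  rw [← Complex.normSq_eq_norm_sq, latticePoint, Complex.normSq_mk, pow_two, pow_two]

lemma summable_exp_neg_mul_int_sq {c : ℝ} (hc : 0 < c) :
    Summable fun n : ℤ => exp (-c * (n : ℝ) ^ 2) := by
  have h := summable_pow_mul_jacobiTheta₂_term_bound 0 (T := c / π) (by positivity) 0
  refine h.congr fun n => ?_
  rw [pow_zero, one_mul]
  congr 1
  field_simp
  ring

lemma summable_exp_neg_mul_latticePoint {c : ℝ} (hc : 0 < c) :
    Summable fun m : ℤ × ℤ => exp (-c * ‖latticePoint m‖ ^ 2) := by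
  have h := summable_exp_neg_mul_int_sq hc
  refine (h.mul_of_nonneg h (fun _ => (exp_pos _).le) (fun _ => (exp_pos _).le)).congr fun m => ?_
  rw [← Real.exp_add, norm_latticePoint_sq, mul_add]

lemma exp_neg_mul_norm_sub_sq_le {E : Type*} [NormedAddCommGroup E] {c : ℝ} (hc : 0 ≤ c) (z w : E) :
    exp (-c * ‖z - w‖ ^ 2) ≤ exp (c * ‖w‖ ^ 2) * exp (-(c / 2) * ‖z‖ ^ 2) := by
  rw [← Real.exp_add, Real.exp_le_exp]
  have h1 : ‖z‖ ≤ ‖z - w‖ + ‖w‖ := by simpa using norm_add_le (z - w) w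
  have h2 : ‖z‖ ^ 2 ≤ 2 * ‖z - w‖ ^ 2 + 2 * ‖w‖ ^ 2 := by
    nlinarith [sq_nonneg (‖z - w‖ - ‖w‖), norm_nonneg z, norm_nonneg w, norm_nonneg (z - w)]
  nlinarith

lemma tsum_int_gaussian_shift {a : ℝ} (ha : 0 < a) (x : ℝ) :
    ∑' n : ℤ, Complex.exp (-π / a * n ^ 2 + 2 * π * (Complex.I * x) * n) =
      ((√a * ∑' n : ℤ, exp (-π * a * (n - x) ^ 2) : ℝ) : ℂ) := by
  have h := Complex.tsum_exp_neg_quadratic (a := ((1 / a : ℝ) : ℂ))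
    (by rw [Complex.ofReal_re]; positivity) (Complex.I * x)
  have e1 : ∀ n : ℤ, (-π : ℂ) * ((1 / a : ℝ) : ℂ) * n ^ 2 = -π / a * n ^ 2 := fun n => by
    push_cast; ring
  simp_rw [e1] at h
  rw [h, Complex.ofReal_mul, Complex.ofReal_tsum]
  congr 1
  · rw [one_div, ← Complex.cpow_neg, Real.sqrt_eq_rpow, Complex.ofReal_cpow ha.le]
    push_cast
    rw [one_div, Complex.inv_cpow _ _
      (by rw [Complex.arg_ofReal_of_nonneg ha.le]; exact pi_ne_zero.symm),
      ← Complex.cpow_neg, neg_neg]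
  · refine tsum_congr fun n => ?_
    push_cast
    congr 1
    have : (n + Complex.I * (Complex.I * x) : ℂ) = n - x := by
      linear_combination (x : ℂ) * Complex.I_sq
    rw [this]
    have : (a : ℂ) ≠ 0 := by exact_mod_cast ha.ne'
    field_simp

/-- Poisson summation for a Gaussian centred at an arbitrary point of the plane. -/
lemma tsum_lattice_gaussian {a : ℝ} (ha : 0 < a) (w : ℂ) :
    ∑' m : ℤ × ℤ, a * exp (-π * a * ‖latticePoint m - w‖ ^ 2) =
      ∑' m : ℤ × ℤ, exp (-(π / a) * ‖latticePoint m‖ ^ 2) *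
        cos (2 * π * ((latticePoint m).re * w.re + (latticePoint m).im * w.im)) := by
  have hpa : 0 < π * a := by positivity
  have hs : ∀ x : ℝ, Summable fun n : ℤ => exp (-π * a * (n - x) ^ 2) := by
    intro x
    refine Summable.of_nonneg_of_le (fun n => (exp_pos _).le) (fun n => ?_)
      ((summable_exp_neg_mul_int_sq (half_pos hpa)).mul_left (exp (π * a * ‖x‖ ^ 2)))
    have := exp_neg_mul_norm_sub_sq_le hpa.le (n : ℝ) x
    simpa only [Real.norm_eq_abs, sq_abs, neg_mul] using this
  have hn : ∀ (x : ℝ) (n : ℤ), ‖Complex.exp (-π / a * n ^ 2 + 2 * π * (Complex.I * x) * n)‖ =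
      exp (-(π / a) * (n : ℝ) ^ 2) := by
    intro x n
    rw [Complex.norm_exp]
    congr 1
    have : (-π / a * n ^ 2 + 2 * π * (Complex.I * x) * n : ℂ) =
        ((-(π / a) * (n : ℝ) ^ 2 : ℝ) : ℂ) + ((2 * π * x * n : ℝ) : ℂ) * Complex.I := by
      push_cast; ring
    rw [this, Complex.add_re, Complex.ofReal_re, Complex.re_ofReal_mul, Complex.I_re, mul_zero,
      add_zero]
  have hsn : ∀ x : ℝ, Summable fun n : ℤ =>
      ‖Complex.exp (-π / a * n ^ 2 + 2 * π * (Complex.I * x) * n)‖ := by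
    intro x
    simp_rw [hn]
    exact summable_exp_neg_mul_int_sq (by positivity)
  have h1 := tsum_mul_tsum_of_summable_norm (hs w.re).norm (hs w.im).norm
  have h2 := tsum_mul_tsum_of_summable_norm (hsn w.re) (hsn w.im)
  rw [tsum_int_gaussian_shift ha, tsum_int_gaussian_shift ha, ← Complex.ofReal_mul,
    mul_mul_mul_comm, Real.mul_self_sqrt ha.le, h1, ← tsum_mul_left] at h2
  have h3 := congrArg Complex.re h2
  rw [Complex.ofReal_re,
    Complex.re_tsum (summable_mul_of_summable_norm (hsn w.re) (hsn w.im))] at h3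
  refine (tsum_congr fun m => ?_).trans (h3.trans (tsum_congr fun m => ?_))
  · rw [← Real.exp_add, ← Complex.normSq_eq_norm_sq, Complex.normSq_apply]
    simp only [latticePoint, Complex.sub_re, Complex.sub_im]
    ring_nf
  · rw [← Complex.exp_add]
    have : (-π / a * m.1 ^ 2 + 2 * π * (Complex.I * w.re) * m.1 +
        (-π / a * m.2 ^ 2 + 2 * π * (Complex.I * w.im) * m.2) : ℂ) =
        ((-(π / a) * ‖latticePoint m‖ ^ 2 : ℝ) : ℂ) +
        ((2 * π * ((latticePoint m).re * w.re + (latticePoint m).im * w.im) : ℝ) : ℂ) *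
          Complex.I := by
      rw [norm_latticePoint_sq]
      simp only [latticePoint]
      push_cast
      ring
    rw [this, Complex.exp_add, ← Complex.ofReal_exp, Complex.re_ofReal_mul,
      Complex.exp_ofReal_mul_I_re]

lemma tsum_exp_neg_latticePoint_le {a : ℝ} (ha : 1 ≤ a) :
    ∑' m : ℤ × ℤ, exp (-(π / a) * ‖latticePoint m‖ ^ 2) ≤
      a * ∑' m : ℤ × ℤ, exp (-π * ‖latticePoint m‖ ^ 2) := by
  have ha0 : 0 < a := by linarith
  have h := tsum_lattice_gaussian ha0 0
  simp only [sub_zero, Complex.zero_re, Complex.zero_im, mul_zero, add_zero, cos_zero, mul_one] at h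
  rw [← h, tsum_mul_left]
  refine mul_le_mul_of_nonneg_left (Summable.tsum_le_tsum (fun m => ?_) ?_ ?_) ha0.le
  · rw [Real.exp_le_exp]
    nlinarith [mul_nonneg (mul_nonneg pi_pos.le (sub_nonneg.2 ha)) (sq_nonneg ‖latticePoint m‖)]
  · simpa only [neg_mul] using summable_exp_neg_mul_latticePoint (mul_pos pi_pos ha0)
  · exact summable_exp_neg_mul_latticePoint pi_pos

lemma hasSum_setIntegral_closedBall {ι : Type*} [Countable ι] {T : ℝ} {f : ι → ℂ → ℝ} {b : ι → ℝ}
    (hf : ∀ i, Continuous (f i)) (hb : Summable b)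
    (hfb : ∀ i, ∀ w ∈ Metric.closedBall (0 : ℂ) T, |f i w| ≤ b i) :
    HasSum (fun i => ∫ w in Metric.closedBall (0 : ℂ) T, f i w)
      (∫ w in Metric.closedBall (0 : ℂ) T, ∑' i, f i w) := by
  have hi : ∀ i, MeasureTheory.IntegrableOn (f i) (Metric.closedBall (0 : ℂ) T) := fun i =>
    (hf i).continuousOn.integrableOn_compact (isCompact_closedBall _ _)
  refine MeasureTheory.hasSum_integral_of_summable_integral_norm hi ?_
  refine Summable.of_nonneg_of_le (fun i => MeasureTheory.integral_nonneg fun _ => norm_nonneg _)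
    (fun i => ?_) (hb.mul_left (MeasureTheory.volume.real (Metric.closedBall (0 : ℂ) T)))
  have := MeasureTheory.setIntegral_mono_on (hi i).norm
    (MeasureTheory.integrableOn_const (C := b i) (isCompact_closedBall (0 : ℂ) T).measure_lt_top.ne)
    measurableSet_closedBall (hfb i)
  simpa using this

lemma hasSum_smoothDisc_latticePoint {a T : ℝ} (ha : 0 < a) :
    HasSum (fun m => smoothDisc a T (latticePoint m))
      (∫ w in Metric.closedBall (0 : ℂ) T,
        ∑' m : ℤ × ℤ, a * exp (-π * a * ‖latticePoint m - w‖ ^ 2)) := by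
  have hpa : 0 < π * a := by positivity
  refine hasSum_setIntegral_closedBall (fun m => by fun_prop)
    (((summable_exp_neg_mul_latticePoint (half_pos hpa)).mul_left
      (exp (π * a * T ^ 2))).mul_left a) fun m w hw => ?_
  rw [mem_closedBall_zero_iff] at hw
  rw [abs_of_nonneg (by positivity)]
  refine mul_le_mul_of_nonneg_left ?_ ha.le
  rw [neg_mul π a]
  refine (exp_neg_mul_norm_sub_sq_le hpa.le _ _).trans ?_
  gcongr

/-- Poisson summation for the mollified disc. -/
lemma hasSum_dual_smoothDisc {a T : ℝ} (ha : 0 < a) (hT : 0 < T) :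
    HasSum (fun m : ℤ × ℤ => exp (-(π / a) * ‖latticePoint m‖ ^ 2) *
      (2 * T ^ 2 * semicircleCos (2 * π * ‖latticePoint m‖ * T)))
      (∑' m, smoothDisc a T (latticePoint m)) := by
  rw [(hasSum_smoothDisc_latticePoint ha).tsum_eq]
  simp_rw [tsum_lattice_gaussian ha, ← setIntegral_closedBall_cos hT,
    ← MeasureTheory.integral_const_mul]
  refine hasSum_setIntegral_closedBall (fun m => by fun_prop)
    (summable_exp_neg_mul_latticePoint (div_pos pi_pos ha)) fun m w _ => ?_
  rw [abs_mul, abs_of_pos (exp_pos _)]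
  exact mul_le_of_le_one_right (exp_pos _).le (abs_cos_le_one _)

lemma semicircleCos_zero : semicircleCos 0 = π / 2 := by
  simp [semicircleCos, integral_sqrt_one_sub_sq]

lemma continuous_smoothDisc (a T : ℝ) : Continuous (smoothDisc a T) := by
  refine continuous_parametric_integral_of_continuous (μ := MeasureTheory.volume)
    (f := fun z w : ℂ => a * exp (-π * a * ‖z - w‖ ^ 2)) ?_ (isCompact_closedBall 0 T)
  fun_prop

lemma integral_gaussian_plane {a : ℝ} (ha : 0 < a) :
    ∫ z : ℂ, a * exp (-π * a * ‖z‖ ^ 2) = 1 := by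
  have h := GaussianFourier.integral_rexp_neg_mul_sq_norm (V := ℂ) (b := π * a) (by positivity)
  rw [Complex.finrank_real_complex] at h
  rw [MeasureTheory.integral_const_mul, neg_mul, h]
  norm_num
  field_simp

lemma integrable_gaussian_plane {a : ℝ} (ha : 0 < a) :
    MeasureTheory.Integrable fun z : ℂ => a * exp (-π * a * ‖z‖ ^ 2) :=
  MeasureTheory.Integrable.of_integral_ne_zero (by
    rw [integral_gaussian_plane ha]
    exact one_ne_zero)

lemma smoothDisc_le_one {a : ℝ} (ha : 0 < a) (T : ℝ) (z : ℂ) : smoothDisc a T z ≤ 1 := by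
  rw [← integral_gaussian_plane ha, ← MeasureTheory.integral_sub_left_eq_self _ _ z]
  exact MeasureTheory.setIntegral_le_integral ((integrable_gaussian_plane ha).comp_sub_left z)
    (MeasureTheory.ae_of_all _ fun w => by positivity)

lemma smoothDisc_eq_convolution (a T : ℝ) : smoothDisc a T =
    MeasureTheory.convolution ((Metric.closedBall (0 : ℂ) T).indicator fun _ => (1 : ℝ))
      (fun z : ℂ => a * exp (-π * a * ‖z‖ ^ 2)) (ContinuousLinearMap.lsmul ℝ ℝ)
      MeasureTheory.volume := by
  ext z
  rw [smoothDisc, MeasureTheory.convolution_def,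
    ← MeasureTheory.integral_indicator measurableSet_closedBall]
  congr 1
  ext w
  by_cases hw : w ∈ Metric.closedBall (0 : ℂ) T <;> simp [Set.indicator, hw]

lemma integrable_indicator_closedBall_one (T : ℝ) : MeasureTheory.Integrable
    ((Metric.closedBall (0 : ℂ) T).indicator fun _ => (1 : ℝ)) :=
  (MeasureTheory.integrable_indicator_iff measurableSet_closedBall).2
    (continuousOn_const.integrableOn_compact (isCompact_closedBall _ _))

lemma integrable_smoothDisc {a : ℝ} (ha : 0 < a) (T : ℝ) :
    MeasureTheory.Integrable (smoothDisc a T) := by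
  rw [smoothDisc_eq_convolution]
  exact (integrable_indicator_closedBall_one T).integrable_convolution _
    (integrable_gaussian_plane ha)

lemma complex_volume_real_closedBall {R : ℝ} (hR : 0 ≤ R) (z : ℂ) :
    MeasureTheory.volume.real (Metric.closedBall z R) = π * R ^ 2 := by
  rw [MeasureTheory.measureReal_def, Complex.volume_closedBall]
  simp [hR, mul_comm]

lemma integral_smoothDisc {a T : ℝ} (ha : 0 < a) (hT : 0 ≤ T) :
    ∫ z, smoothDisc a T z = π * T ^ 2 := by
  rw [smoothDisc_eq_convolution, MeasureTheory.integral_convolution _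
    (integrable_indicator_closedBall_one T) (integrable_gaussian_plane ha),
    integral_gaussian_plane ha, MeasureTheory.integral_indicator measurableSet_closedBall]
  simp [complex_volume_real_closedBall hT]

lemma setOf_le_smoothDisc {a T t : ℝ} (ha : 0 < a) (hT : 0 ≤ T) (ht : 0 < t) :
    {z | t ≤ smoothDisc a T z} = ∅ ∨
      ∃ R, 0 ≤ R ∧ {z | t ≤ smoothDisc a T z} = Metric.closedBall (0 : ℂ) R := by
  rcases Set.eq_empty_or_nonempty {z : ℂ | t ≤ smoothDisc a T z} with h | ⟨z₀, hz₀⟩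
  · exact Or.inl h
  right
  set S : Set ℝ := {r | 0 ≤ r ∧ t ≤ smoothDisc a T (r : ℂ)} with hS
  have hne : S.Nonempty := ⟨‖z₀‖, norm_nonneg z₀, by rw [← smoothDisc_eq_norm]; exact hz₀⟩
  have hbdd : BddAbove S := by
    by_contra hb
    have huniv : {z | t ≤ ‖smoothDisc a T z‖} = Set.univ := by
      refine Set.eq_univ_of_forall fun z => ?_
      obtain ⟨s, hs, hzs⟩ := not_bddAbove_iff.1 hb ‖z‖
      refine le_trans ?_ (le_abs_self (smoothDisc a T z))
      rw [smoothDisc_eq_norm]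
      exact hs.2.trans (smoothDisc_antitone ha hT (norm_nonneg z) hzs.le)
    have := (integrable_smoothDisc ha T).measure_norm_ge_lt_top ht
    rw [huniv] at this
    simp at this
  have hclosed : IsClosed S :=
    isClosed_Ici.inter (isClosed_le continuous_const
      ((continuous_smoothDisc a T).comp Complex.continuous_ofReal))
  have hmem := hclosed.csSup_mem hne hbdd
  refine ⟨sSup S, hmem.1, Set.ext fun z => ?_⟩
  rw [mem_closedBall_zero_iff, Set.mem_ofPred_eq, smoothDisc_eq_norm]
  exact ⟨fun h => le_csSup hbdd ⟨norm_nonneg z, h⟩,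
    fun h => hmem.2.trans (smoothDisc_antitone ha hT (norm_nonneg z) h)⟩

lemma count_real_latticePoint_closedBall {R : ℝ} (hR : 0 ≤ R) :
    MeasureTheory.Measure.count.real {m | latticePoint m ∈ Metric.closedBall (0 : ℂ) R} =
      latticeA (R ^ 2) := by
  rw [MeasureTheory.measureReal_def,
    MeasureTheory.Measure.count_apply (Set.to_countable _).measurableSet, latticeA, Set.ncard]
  have : {m | latticePoint m ∈ Metric.closedBall (0 : ℂ) R} =
      {p : ℤ × ℤ | (p.1 : ℝ) ^ 2 + (p.2 : ℝ) ^ 2 ≤ R ^ 2} := by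
    ext m
    rw [Set.mem_ofPred_eq, Set.mem_ofPred_eq, mem_closedBall_zero_iff, ← norm_latticePoint_sq,
      sq_le_sq₀ (norm_nonneg _) hR]
  rw [this]
  cases Set.encard {p : ℤ × ℤ | (p.1 : ℝ) ^ 2 + (p.2 : ℝ) ^ 2 ≤ R ^ 2} <;> simp

lemma integrableOn_measureReal_setOf_le {α : Type*} [MeasurableSpace α]
    {μ : MeasureTheory.Measure α} {f : α → ℝ} (hf : MeasureTheory.Integrable f μ)
    (h0 : 0 ≤ f) :
    MeasureTheory.IntegrableOn (fun t => μ.real {x | t ≤ f x}) (Set.Ioc 0 1) := by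
  have hanti : Antitone fun t => μ {x | t ≤ f x} := fun s t hst =>
    MeasureTheory.measure_mono fun x (hx : t ≤ f x) => hst.trans hx
  have := MeasureTheory.integrable_toReal_of_lintegral_ne_top
    (μ := MeasureTheory.volume.restrict (Set.Ioi (0 : ℝ))) hanti.measurable.aemeasurable
    (by
      rw [← MeasureTheory.lintegral_eq_lintegral_meas_le μ (MeasureTheory.ae_of_all _ h0)
        hf.aemeasurable]
      exact hf.lintegral_lt_top.ne)
  exact MeasureTheory.IntegrableOn.mono_set this Set.Ioc_subset_Ioi_self

/-- The mollified discrepancy `∑ F(m) - ∫ F` is an average of values of `latticeP`. -/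
lemma smoothDisc_discrepancy_aux {a T : ℝ} (ha : 0 < a) (hT : 0 ≤ T) :
    ∃ N V : ℝ → ℝ, MeasureTheory.IntegrableOn N (Set.Ioc 0 1) ∧
      MeasureTheory.IntegrableOn V (Set.Ioc 0 1) ∧
      ∑' m, smoothDisc a T (latticePoint m) = ∫ t in Set.Ioc 0 1, N t ∧
      π * T ^ 2 = ∫ t in Set.Ioc 0 1, V t ∧
      ∀ t ∈ Set.Ioc (0 : ℝ) 1, (N t = 0 ∧ V t = 0) ∨
        ∃ x, 0 ≤ x ∧ V t = π * x ∧ N t - V t = latticeP x := by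
  have h0 : 0 ≤ smoothDisc a T := smoothDisc_nonneg ha.le T
  have hint : MeasureTheory.Integrable (fun m => smoothDisc a T (latticePoint m))
      MeasureTheory.Measure.count :=
    MeasureTheory.integrable_count_iff.2 (hasSum_smoothDisc_latticePoint ha).summable.norm
  refine ⟨_, _, integrableOn_measureReal_setOf_le hint fun m => h0 _,
    integrableOn_measureReal_setOf_le (integrable_smoothDisc ha T) h0, ?_, ?_, fun t ht => ?_⟩
  · rw [← hint.integral_eq_integral_Ioc_meas_le (MeasureTheory.ae_of_all _ fun m => h0 _)
      (MeasureTheory.ae_of_all _ fun m => smoothDisc_le_one ha T _),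
      MeasureTheory.integral_countable hint]
    simp
  · rw [← (integrable_smoothDisc ha T).integral_eq_integral_Ioc_meas_le
      (MeasureTheory.ae_of_all _ h0) (MeasureTheory.ae_of_all _ (smoothDisc_le_one ha T)),
      integral_smoothDisc ha hT]
  · have hpre : {m | t ≤ smoothDisc a T (latticePoint m)} =
        {m | latticePoint m ∈ {z | t ≤ smoothDisc a T z}} := rfl
    rw [hpre]
    rcases setOf_le_smoothDisc ha hT ht.1 with h | ⟨R, hR, h⟩
    · left
      rw [h]
      simp
    · right
      rw [h, count_real_latticePoint_closedBall hR, complex_volume_real_closedBall hR]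
      exact ⟨R ^ 2, by positivity, rfl, rfl⟩

lemma smoothDisc_discrepancy_le {a T α β : ℝ} (ha : 0 < a) (hT : 0 ≤ T) (hα : 0 ≤ α)
    (h : ∀ x, 0 ≤ x → latticeP x ≤ α + β * x) :
    ∑' m, smoothDisc a T (latticePoint m) - π * T ^ 2 ≤ α + β * T ^ 2 := by
  obtain ⟨N, V, hN, hV, eN, eV, hNV⟩ := smoothDisc_discrepancy_aux ha hT
  have hc : MeasureTheory.IntegrableOn (fun _ : ℝ => α) (Set.Ioc 0 1) := by simp
  have key := MeasureTheory.setIntegral_mono_on (hN.sub hV) (hc.add (hV.const_mul (β / π)))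
    measurableSet_Ioc fun t ht => by
      show N t - V t ≤ α + β / π * V t
      rcases hNV t ht with ⟨h1, h2⟩ | ⟨x, hx, h1, h2⟩
      · simpa [h1, h2] using hα
      · rw [h2, h1, ← mul_assoc, div_mul_cancel₀ _ pi_ne_zero]
        exact h x hx
  simp only [Pi.sub_apply, Pi.add_apply] at key
  rw [MeasureTheory.integral_sub hN hV, MeasureTheory.integral_add hc (hV.const_mul _),
    MeasureTheory.integral_const_mul, ← eN, ← eV, ← mul_assoc, div_mul_cancel₀ _ pi_ne_zero] at key
  simpa using key

lemma le_smoothDisc_discrepancy {a T α β : ℝ} (ha : 0 < a) (hT : 0 ≤ T) (hα : 0 ≤ α)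
    (h : ∀ x, 0 ≤ x → -(α + β * x) ≤ latticeP x) :
    -(α + β * T ^ 2) ≤ ∑' m, smoothDisc a T (latticePoint m) - π * T ^ 2 := by
  obtain ⟨N, V, hN, hV, eN, eV, hNV⟩ := smoothDisc_discrepancy_aux ha hT
  have hc : MeasureTheory.IntegrableOn (fun _ : ℝ => α) (Set.Ioc 0 1) := by simp
  have key := MeasureTheory.setIntegral_mono_on (hV.sub hN) (hc.add (hV.const_mul (β / π)))
    measurableSet_Ioc fun t ht => by
      show V t - N t ≤ α + β / π * V t
      rcases hNV t ht with ⟨h1, h2⟩ | ⟨x, hx, h1, h2⟩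
      · simpa [h1, h2] using hα
      · rw [h1, ← mul_assoc, div_mul_cancel₀ _ pi_ne_zero]
        have := h x hx
        linarith
  simp only [Pi.sub_apply, Pi.add_apply] at key
  rw [MeasureTheory.integral_sub hV hN, MeasureTheory.integral_add hc (hV.const_mul _),
    MeasureTheory.integral_const_mul, ← eN, ← eV, ← mul_assoc, div_mul_cancel₀ _ pi_ne_zero] at key
  have : ∫ _ in Set.Ioc (0 : ℝ) 1, α = α := by simp
  linarith

lemma one_le_norm_latticePoint {m : ℤ × ℤ} (hm : m ≠ 0) : 1 ≤ ‖latticePoint m‖ := by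
  have h : 1 ≤ m.1 ^ 2 + m.2 ^ 2 := by
    by_contra! hlt
    refine hm (Prod.ext ?_ ?_)
    · exact pow_eq_zero_iff two_ne_zero |>.1 (by nlinarith [sq_nonneg m.1, sq_nonneg m.2])
    · exact pow_eq_zero_iff two_ne_zero |>.1 (by nlinarith [sq_nonneg m.1, sq_nonneg m.2])
  have h' : (1 : ℝ) ≤ ‖latticePoint m‖ ^ 2 := by
    rw [norm_latticePoint_sq]
    exact_mod_cast h
  exact (one_le_sq_iff₀ (norm_nonneg _)).1 h'

lemma latticePoint_zero : latticePoint 0 = 0 := by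
  simp [latticePoint, Complex.ext_iff]

/-- The leading term of the contribution of the dual lattice point `m` to the discrepancy of the
mollified disc; it vanishes at `m = 0`. -/
noncomputable def latticeOsc (a T : ℝ) (m : ℤ × ℤ) : ℝ :=
  ‖latticePoint m‖ ^ (-(3 / 2) : ℝ) * exp (-(π / a) * ‖latticePoint m‖ ^ 2) *
    cos (2 * π * ‖latticePoint m‖ * T + π / 4)

lemma latticeOsc_zero (a T : ℝ) : latticeOsc a T 0 = 0 := by
  rw [latticeOsc, latticePoint_zero, norm_zero, zero_rpow (by norm_num), zero_mul, zero_mul]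

lemma norm_latticePoint_rpow_le_one (m : ℤ × ℤ) : ‖latticePoint m‖ ^ (-(3 / 2) : ℝ) ≤ 1 := by
  rcases eq_or_ne m 0 with rfl | hm
  · rw [latticePoint_zero, norm_zero, zero_rpow (by norm_num)]
    exact zero_le_one
  · exact rpow_le_one_of_one_le_of_nonpos (one_le_norm_latticePoint hm) (by norm_num)

lemma abs_latticeOsc_le (a T : ℝ) (m : ℤ × ℤ) :
    |latticeOsc a T m| ≤ exp (-(π / a) * ‖latticePoint m‖ ^ 2) := by
  rw [latticeOsc, abs_mul, abs_mul, abs_of_pos (exp_pos _), abs_of_nonneg (by positivity)]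
  refine (mul_le_of_le_one_right (by positivity) (abs_cos_le_one _)).trans ?_
  exact mul_le_of_le_one_left (exp_pos _).le (norm_latticePoint_rpow_le_one m)

lemma summable_latticeOsc {a : ℝ} (ha : 0 < a) (T : ℝ) : Summable (latticeOsc a T) :=
  (summable_exp_neg_mul_latticePoint (div_pos pi_pos ha)).of_norm_bounded (abs_latticeOsc_le a T)

lemma semicircle_main_term {r T : ℝ} (hr : 0 < r) (hT : 0 < T) :
    2 * T ^ 2 * (√(2 * π) * (2 * π * r * T) ^ (-(3 / 2) : ℝ)) =
      √T / π * r ^ (-(3 / 2) : ℝ) := by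
  have hp : 0 < 2 * π := by positivity
  have hT2 : T ^ 2 * T ^ (-(3 / 2) : ℝ) = √T := by
    rw [sqrt_eq_rpow, ← rpow_natCast, ← rpow_add hT]
    norm_num
  have hpi : √(2 * π) * (2 * π) ^ (-(3 / 2) : ℝ) = (2 * π)⁻¹ := by
    rw [sqrt_eq_rpow, ← rpow_add hp, ← rpow_neg_one]
    norm_num
  rw [mul_rpow (by positivity) hT.le, mul_rpow hp.le hr.le]
  calc _ = 2 * (√(2 * π) * (2 * π) ^ (-(3 / 2) : ℝ)) * (T ^ 2 * T ^ (-(3 / 2) : ℝ)) *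
        r ^ (-(3 / 2) : ℝ) := by ring
    _ = _ := by
      rw [hT2, hpi]
      field_simp

/-- A smoothed Hardy–Voronoi formula for the discrepancy. -/
lemma exists_smoothDisc_discrepancy_approx : ∃ C, 0 < C ∧ ∀ a T : ℝ, 0 < a → 0 < T →
    |∑' m, smoothDisc a T (latticePoint m) - π * T ^ 2 + √T / π * ∑' m, latticeOsc a T m| ≤
      C / √T * ∑' m : ℤ × ℤ, exp (-(π / a) * ‖latticePoint m‖ ^ 2) := by
  obtain ⟨C, hC, hsc⟩ := exists_semicircleCos_approx
  refine ⟨2 * C, by positivity, fun a T ha hT => ?_⟩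
  have hsum := ((hasSum_dual_smoothDisc ha hT).sub (hasSum_ite_eq (0 : ℤ × ℤ) (π * T ^ 2))).add
    ((summable_latticeOsc ha T).hasSum.mul_left (√T / π))
  rw [← hsum.tsum_eq, ← tsum_mul_left]
  rw [← Real.norm_eq_abs]
  refine tsum_of_norm_bounded ((summable_exp_neg_mul_latticePoint
    (div_pos pi_pos ha)).mul_left (2 * C / √T)).hasSum fun m => ?_
  rw [Real.norm_eq_abs]
  rcases eq_or_ne m 0 with rfl | hm
  · rw [latticeOsc_zero, if_pos rfl, latticePoint_zero, norm_zero, mul_zero, zero_mul,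
      semicircleCos_zero]
    have : exp (-(π / a) * 0 ^ 2) * (2 * T ^ 2 * (π / 2)) - π * T ^ 2 + √T / π * 0 = 0 := by
      rw [zero_pow two_ne_zero, mul_zero, exp_zero]
      ring
    rw [this, abs_zero]
    positivity
  · have hm1 := one_le_norm_latticePoint hm
    set r := ‖latticePoint m‖ with hr
    have hr0 : 0 < r := by linarith
    set z := 2 * π * r * T with hz
    have hz0 : 0 < z := by positivity
    have hzT : T ≤ z := by
      have : 1 ≤ 2 * π * r := by nlinarith [pi_gt_three]
      exact le_mul_of_one_le_left hT.le this
    have hTp : T ^ 2 * T ^ (-(5 / 2) : ℝ) = 1 / √T := by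
      rw [sqrt_eq_rpow, one_div, ← rpow_neg hT.le, ← rpow_natCast, ← rpow_add hT]
      norm_num
    rw [if_neg hm, sub_zero]
    have heq : exp (-(π / a) * r ^ 2) * (2 * T ^ 2 * semicircleCos z) +
        √T / π * latticeOsc a T m = exp (-(π / a) * r ^ 2) * (2 * T ^ 2 *
          (semicircleCos z + √(2 * π) * z ^ (-(3 / 2) : ℝ) * cos (z + π / 4))) := by
      rw [latticeOsc, ← hr, ← hz]
      linear_combination (-exp (-(π / a) * r ^ 2) * cos (z + π / 4)) *
        semicircle_main_term hr0 hT
    rw [heq, abs_mul, abs_mul, abs_of_pos (exp_pos _), abs_of_pos (by positivity), mul_comm]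
    refine mul_le_mul_of_nonneg_right ?_ (exp_pos _).le
    calc _ ≤ 2 * T ^ 2 * (C * z ^ (-(5 / 2) : ℝ)) := by gcongr; exact hsc z hz0
      _ ≤ 2 * T ^ 2 * (C * T ^ (-(5 / 2) : ℝ)) := by
        gcongr 2 * T ^ 2 * (C * ?_)
        exact rpow_le_rpow_of_nonpos hT hzT (by norm_num)
      _ = 2 * C * (T ^ 2 * T ^ (-(5 / 2) : ℝ)) := by ring
      _ = _ := by rw [hTp]; ring

lemma latticeA_mono {x y : ℝ} (hxy : x ≤ y) : latticeA x ≤ latticeA y := by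
  refine Set.ncard_le_ncard (fun p (hp : _ ≤ x) => hp.trans hxy) ?_
  have habs : ∀ n : ℤ, |(n : ℝ)| ≤ (n : ℝ) ^ 2 := fun n => by
    rw [← sq_abs]
    exact_mod_cast Int.le_self_sq |n|
  refine ((Set.finite_Icc ⌈-y⌉ ⌊y⌋).prod (Set.finite_Icc ⌈-y⌉ ⌊y⌋)).subset fun p hp => ?_
  rw [Set.mem_ofPred_eq] at hp
  have h1 := abs_le.1 ((habs p.1).trans (by nlinarith [sq_nonneg (p.2 : ℝ)] : _ ≤ y))
  have h2 := abs_le.1 ((habs p.2).trans (by nlinarith [sq_nonneg (p.1 : ℝ)] : _ ≤ y))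
  exact ⟨⟨Int.ceil_le.2 h1.1, Int.le_floor.2 h1.2⟩, ⟨Int.ceil_le.2 h2.1, Int.le_floor.2 h2.2⟩⟩

lemma rpow_quarter_le {x T : ℝ} (hx : 0 ≤ x) (hT : 0 < T) :
    x ^ ((1 : ℝ) / 4) ≤ √T * (1 + x / T ^ 2) := by
  have hu : 0 ≤ x / T ^ 2 := by positivity
  have h1 : x ^ ((1 : ℝ) / 4) = √T * (x / T ^ 2) ^ ((1 : ℝ) / 4) := by
    rw [div_rpow hx (by positivity), ← rpow_natCast, ← rpow_mul hT.le, sqrt_eq_rpow]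
    norm_num
    field_simp
  have h2 := rpow_one_add_le_one_add_mul_self (s := x / T ^ 2 - 1) (by linarith)
    (p := 1 / 4) (by norm_num) (by norm_num)
  rw [add_sub_cancel] at h2
  rw [h1]
  gcongr
  linarith

lemma norm_latticePoint_eq_one_or_two_le {m : ℤ × ℤ} (hm : m ≠ 0) :
    ‖latticePoint m‖ = 1 ∨ 2 ≤ ‖latticePoint m‖ ^ 2 := by
  have h1 := one_le_norm_latticePoint hm
  by_cases h : m.1 ^ 2 + m.2 ^ 2 < 2
  · left
    have h' : ((m.1 : ℝ) ^ 2 + (m.2 : ℝ) ^ 2) ≤ 1 := by exact_mod_cast Int.lt_add_one_iff.1 h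
    rw [← norm_latticePoint_sq] at h'
    nlinarith
  · right
    rw [norm_latticePoint_sq]
    exact_mod_cast not_lt.1 h

lemma tsum_exp_neg_pi_pos : 0 < ∑' m : ℤ × ℤ, exp (-π * ‖latticePoint m‖ ^ 2) :=
  (summable_exp_neg_mul_latticePoint pi_pos).tsum_pos (fun _ => (exp_pos _).le) 0 (exp_pos _)

lemma exists_tsum_latticeOsc_le_neg :
    ∃ a c : ℝ, 0 < a ∧ 0 < c ∧ ∀ k : ℕ, ∑' m, latticeOsc a (k + 3 / 8) m ≤ -c := by
  set S := ∑' m : ℤ × ℤ, exp (-π * ‖latticePoint m‖ ^ 2) with hS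
  have hSpos : 0 < S := tsum_exp_neg_pi_pos
  obtain ⟨β, hβ0, hβ⟩ : ∃ β : ℝ, 0 ≤ β ∧ exp (-(π * β)) * S < exp (-π) := by
    have h : Tendsto (fun β : ℝ => exp (-(π * β)) * S) atTop (nhds (0 * S)) :=
      ((tendsto_exp_neg_atTop_nhds_zero.comp
        (tendsto_id.const_mul_atTop pi_pos)).mul_const S)
    rw [zero_mul] at h
    exact ((eventually_ge_atTop 0).and (h.eventually_lt_const (exp_pos (-π)))).exists
  have hβ1 : 0 < 1 + β := by linarith
  refine ⟨(1 + β)⁻¹, exp (-(π * β)) * (exp (-π) - exp (-(π * β)) * S), by positivity,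
    mul_pos (exp_pos _) (by linarith), fun k => ?_⟩
  have hsum := (hasSum_ite_eq ((1, 0) : ℤ × ℤ) (-exp (-(π * (1 + β))))).add
    ((summable_exp_neg_mul_latticePoint pi_pos).hasSum.mul_left (exp (-(2 * (π * β)))))
  refine (hasSum_le (fun m => ?_) (summable_latticeOsc (inv_pos.2 hβ1) _).hasSum hsum).trans ?_
  · rcases eq_or_ne m 0 with rfl | hm
    · rw [latticeOsc_zero, if_neg (by decide), zero_add]
      positivity
    rcases norm_latticePoint_eq_one_or_two_le hm with h | h
    · have hcos : cos (2 * π * 1 * (k + 3 / 8) + π / 4) = -1 := by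
        rw [← cos_pi, ← cos_add_nat_mul_two_pi π k]
        congr 1
        ring
      rw [latticeOsc, h, one_rpow, one_mul, one_pow, mul_one, hcos, mul_neg, mul_one, mul_one,
        div_inv_eq_mul]
      have : 0 < exp (-(2 * (π * β))) * exp (-π) := by positivity
      have : 0 < exp (-(π * (1 + β))) := exp_pos _
      split_ifs <;> linarith
    · have hne : m ≠ (1, 0) := by
        rintro rfl
        rw [norm_latticePoint_sq] at h
        norm_num at h
      rw [if_neg hne, zero_add, ← Real.exp_add]
      refine ((le_abs_self _).trans (abs_latticeOsc_le _ _ m)).trans (exp_le_exp.2 ?_)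
      rw [div_inv_eq_mul]
      nlinarith [mul_le_mul_of_nonneg_left h (mul_nonneg pi_pos.le hβ0)]
  · rw [← hS, mul_add, mul_one, neg_add, Real.exp_add, two_mul, neg_add, Real.exp_add]
    apply le_of_eq
    ring

theorem latticeP_omega_plus :
    ∃ c : ℝ, 0 < c ∧ ∃ᶠ x : ℝ in atTop, c * x ^ ((1 : ℝ) / 4) ≤ latticeP x := by
  obtain ⟨a, c, ha, hc, hosc⟩ := exists_tsum_latticeOsc_le_neg
  obtain ⟨C, hC, happrox⟩ := exists_smoothDisc_discrepancy_approx
  set S := ∑' m : ℤ × ℤ, exp (-(π / a) * ‖latticePoint m‖ ^ 2)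
  have hS : 0 ≤ S := tsum_nonneg fun _ => (exp_pos _).le
  refine ⟨c / (4 * π), by positivity, fun hcon => ?_⟩
  simp only [not_le] at hcon
  obtain ⟨X, hX⟩ := eventually_atTop.1 hcon
  obtain ⟨k, hk⟩ := exists_nat_ge (((latticeA X + C * S + 1) * (2 * π / c)) ^ 2 + 1)
  set T : ℝ := k + 3 / 8 with hTdef
  have hT1 : 1 ≤ T := by nlinarith [sq_nonneg ((latticeA X + C * S + 1) * (2 * π / c))]
  have hT : 0 < T := by linarith
  have hsT : (latticeA X + C * S + 1) * (2 * π / c) ≤ √T := le_sqrt_of_sq_le (by linarith)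
  have hupper := smoothDisc_discrepancy_le (T := T) (α := latticeA X + c / (4 * π) * √T)
    (β := c / (4 * π) * √T / T ^ 2) ha hT.le (by positivity) fun x hx => by
      rcases le_total X x with h | h
      · have h1 := (hX x h).le.trans
          (mul_le_mul_of_nonneg_left (rpow_quarter_le hx hT) (by positivity))
        have h2 : (0 : ℝ) ≤ latticeA X := Nat.cast_nonneg _
        refine h1.trans ?_
        rw [mul_add, mul_add, mul_one, mul_div_assoc', mul_div_assoc', ← mul_assoc, add_assoc,
          mul_div_right_comm]
        linarith
      · have h1 : (latticeA x : ℝ) ≤ latticeA X := by exact_mod_cast latticeA_mono h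
        have h2 : 0 ≤ c / (4 * π) * √T + c / (4 * π) * √T / T ^ 2 * x := by positivity
        have h3 : 0 ≤ π * x := by positivity
        rw [latticeP]
        linarith
  rw [div_mul_cancel₀ _ (by positivity)] at hupper
  have hlower := (abs_le.1 (happrox a T ha hT)).1
  have h1 : √T / π * ∑' m, latticeOsc a T m ≤ √T / π * -c :=
    mul_le_mul_of_nonneg_left (hosc k) (by positivity)
  have h2 : C / √T * S ≤ C * S := by
    gcongr
    exact div_le_self hC.le (one_le_sqrt.2 hT1)
  have h3 : c / (4 * π) * √T = √T / π * c / 4 := by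
    field_simp
  have h4 : latticeA X + C * S + 1 ≤ √T / π * c / 2 := by
    have := mul_le_mul_of_nonneg_right hsT (by positivity : 0 ≤ c / (2 * π))
    calc _ = (latticeA X + C * S + 1) * (2 * π / c) * (c / (2 * π)) := by field_simp
      _ ≤ _ := this
      _ = _ := by field_simp
  linarith

/-- Dirichlet's theorem on simultaneous approximation. -/
lemma exists_nat_mul_near_int (M : ℕ) {Q : ℕ} (hQ : 0 < Q) (θ : Fin M → ℝ) :
    ∃ t : ℕ, 1 ≤ t ∧ t ≤ Q ^ M ∧ ∀ i, ∃ p : ℤ, |t * θ i - p| ≤ 1 / Q := by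
  have hQ' : (0 : ℝ) < Q := by exact_mod_cast hQ
  let f : Fin (Q ^ M + 1) → Fin M → Fin Q := fun t i =>
    ⟨⌊Q * Int.fract ((t : ℕ) * θ i)⌋₊, (Nat.floor_lt (by positivity)).2
      (mul_lt_of_lt_one_right hQ' (Int.fract_lt_one _))⟩
  obtain ⟨s, t, hst, hf⟩ := Fintype.exists_ne_map_eq_of_card_lt f (by simp)
  wlog hlt : s < t generalizing s t
  · exact this t s hst.symm hf.symm (lt_of_le_of_ne (not_lt.1 hlt) hst.symm)
  have hlt' : (s : ℕ) < t := hlt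
  refine ⟨t - s, by omega, by omega, fun i => ?_⟩
  have hfl : ⌊Q * Int.fract ((s : ℕ) * θ i)⌋₊ = ⌊Q * Int.fract ((t : ℕ) * θ i)⌋₊ :=
    congrArg Fin.val (congrFun hf i)
  have h1 := Nat.floor_le (by positivity : 0 ≤ Q * Int.fract ((s : ℕ) * θ i))
  have h2 := Nat.floor_le (by positivity : 0 ≤ Q * Int.fract ((t : ℕ) * θ i))
  have h3 := Nat.lt_floor_add_one (Q * Int.fract ((s : ℕ) * θ i))
  have h4 := Nat.lt_floor_add_one (Q * Int.fract ((t : ℕ) * θ i))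
  rw [hfl] at h1 h3
  refine ⟨⌊(t : ℕ) * θ i⌋ - ⌊(s : ℕ) * θ i⌋, ?_⟩
  have heq : ((t - s : ℕ) : ℝ) * θ i - ((⌊(t : ℕ) * θ i⌋ - ⌊(s : ℕ) * θ i⌋ : ℤ) : ℝ) =
      Int.fract ((t : ℕ) * θ i) - Int.fract ((s : ℕ) * θ i) := by
    rw [Nat.cast_sub hlt'.le, Int.fract, Int.fract]
    push_cast
    ring
  rw [heq, abs_le, ← neg_div, div_le_iff₀ hQ', le_div_iff₀ hQ']
  constructor <;> linarith

/-- There are radii of controlled size at which all the low-frequency dual terms are in phase. -/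
lemma exists_radius_in_phase (K L : ℕ) :
    ∃ T : ℝ, (L : ℝ) ^ 2 ≤ T ∧ T ≤ L ^ 2 * 24 ^ (K * L ^ 2 + 1) ∧
      ∀ m, m ≠ 0 → ‖latticePoint m‖ ^ 2 ≤ K * L ^ 2 →
        1 / 2 ≤ cos (2 * π * ‖latticePoint m‖ * T + π / 4) := by
  obtain ⟨t, ht1, ht2, ht⟩ := exists_nat_mul_near_int (K * L ^ 2 + 1) (Q := 24) (by norm_num)
    fun n => √(n : ℕ) * L ^ 2
  have ht1' : (1 : ℝ) ≤ t := by exact_mod_cast ht1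
  have ht2' : (t : ℝ) ≤ 24 ^ (K * L ^ 2 + 1) := by exact_mod_cast ht2
  refine ⟨L ^ 2 * t, le_mul_of_one_le_right (by positivity) ht1', by gcongr, fun m _ hm => ?_⟩
  have hn : ‖latticePoint m‖ ^ 2 = ((m.1.natAbs ^ 2 + m.2.natAbs ^ 2 : ℕ) : ℝ) := by
    rw [norm_latticePoint_sq]
    push_cast
    rw [Nat.cast_natAbs, Nat.cast_natAbs, Int.cast_abs, Int.cast_abs, sq_abs, sq_abs]
  have hle : m.1.natAbs ^ 2 + m.2.natAbs ^ 2 ≤ K * L ^ 2 := by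
    rw [hn] at hm
    exact_mod_cast hm
  obtain ⟨p, hp⟩ := ht ⟨_, Nat.lt_succ_of_le hle⟩
  simp only [← hn, sqrt_sq (norm_nonneg _)] at hp
  set δ := t * (‖latticePoint m‖ * L ^ 2) - p with hδ
  have hphase : 2 * π * ‖latticePoint m‖ * (L ^ 2 * t) + π / 4 =
      2 * π * δ + π / 4 + p * (2 * π) := by
    rw [hδ]
    ring
  rw [hphase, cos_add_int_mul_two_pi, ← cos_pi_div_three]
  have h := abs_le.1 hp
  have hpi := pi_pos
  push_cast at h
  exact cos_le_cos_of_nonneg_of_le_pi (by nlinarith) (by linarith) (by nlinarith)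

lemma exists_le_tsum_latticeOsc :
    ∃ K : ℕ, ∃ c : ℝ, 0 < K ∧ 0 < c ∧ ∀ L : ℕ, 0 < L → ∀ T : ℝ,
      (∀ m, m ≠ 0 → ‖latticePoint m‖ ^ 2 ≤ K * L ^ 2 →
        1 / 2 ≤ cos (2 * π * ‖latticePoint m‖ * T + π / 4)) →
      c * √L ≤ ∑' m, latticeOsc (L ^ 2) T m := by
  set S := ∑' m : ℤ × ℤ, exp (-π * ‖latticePoint m‖ ^ 2) with hS
  have hSpos : 0 < S := tsum_exp_neg_pi_pos
  obtain ⟨K, hK2, hK⟩ : ∃ K : ℕ, 2 ≤ K ∧ exp (-(π / 2 * K)) * (2 * S) < exp (-(2 * π)) / 4 := by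
    have h : Tendsto (fun K : ℕ => exp (-(π / 2 * K)) * (2 * S)) atTop (nhds (0 * (2 * S))) :=
      ((tendsto_exp_neg_atTop_nhds_zero.comp
        (tendsto_natCast_atTop_atTop.const_mul_atTop (half_pos pi_pos))).mul_const (2 * S))
    rw [zero_mul] at h
    exact ((eventually_ge_atTop 2).and (h.eventually_lt_const (by positivity))).exists
  have hK2' : (2 : ℝ) ≤ K := by exact_mod_cast hK2
  refine ⟨K, exp (-(2 * π)) / 4 - exp (-(π / 2 * K)) * (2 * S), by omega, by linarith,
    fun L hL T hcos => ?_⟩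
  have hL0 : (0 : ℝ) < L := by exact_mod_cast hL
  have hL1 : (1 : ℝ) ≤ L := by exact_mod_cast hL
  have hLsq : (0 : ℝ) < L ^ 2 := by positivity
  set w : ℝ := ((L : ℝ) ^ 2) ^ (-(3 / 4) : ℝ) with hw
  have hw0 : 0 < w := by positivity
  have hwL : L ^ 2 * w = √L := by
    rw [hw, ← rpow_natCast, ← rpow_mul hL0.le, ← rpow_add hL0, sqrt_eq_rpow]
    norm_num
  have hrpow : ∀ m, ‖latticePoint m‖ ^ (-(3 / 2) : ℝ) =
      (‖latticePoint m‖ ^ 2) ^ (-(3 / 4) : ℝ) := fun m => by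
    rw [← rpow_natCast, ← rpow_mul (norm_nonneg _)]
    norm_num
  set B : Finset (ℤ × ℤ) := Finset.Icc 1 (L : ℤ) ×ˢ Finset.Icc 1 (L : ℤ) with hB
  have hBsum : HasSum (fun m => if m ∈ B then w * exp (-(2 * π)) / 4 else 0)
      (L ^ 2 * (w * exp (-(2 * π)) / 4)) := by
    have h := hasSum_sum_of_ne_finset_zero (s := B)
      (L := SummationFilter.unconditional (ℤ × ℤ))
      (f := fun m => if m ∈ B then w * exp (-(2 * π)) / 4 else 0) fun m hm => if_neg hm
    have hcard : (B.card : ℝ) = L ^ 2 := by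
      simp [hB, pow_two]
    rwa [Finset.sum_ite_mem, Finset.inter_self, Finset.sum_const, nsmul_eq_mul, hcard] at h
  have hmem : ∀ m ∈ B, m ≠ 0 ∧ ‖latticePoint m‖ ^ 2 ≤ 2 * L ^ 2 := by
    intro m hm
    rw [hB, Finset.mem_product, Finset.mem_Icc, Finset.mem_Icc] at hm
    refine ⟨?_, ?_⟩
    · rintro rfl
      simp at hm
    · rw [norm_latticePoint_sq]
      have h1 : m.1 ^ 2 + m.2 ^ 2 ≤ 2 * (L : ℤ) ^ 2 := by nlinarith
      exact_mod_cast h1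
  have hgauss : Summable fun m => exp (-(π / (2 * L ^ 2)) * ‖latticePoint m‖ ^ 2) :=
    summable_exp_neg_mul_latticePoint (by positivity)
  have hsum := hBsum.sub (hgauss.hasSum.mul_left (w * exp (-(π / 2 * K))))
  refine le_trans ?_ (hasSum_le (fun m => ?_) hsum (summable_latticeOsc hLsq T).hasSum)
  · have h := tsum_exp_neg_latticePoint_le (a := 2 * L ^ 2) (by nlinarith)
    rw [← hS] at h
    have h2 := mul_le_mul_of_nonneg_left h (by positivity : 0 ≤ w * exp (-(π / 2 * K)))
    rw [← hwL]
    linarith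
  · have hgpos : 0 < w * exp (-(π / 2 * K)) * exp (-(π / (2 * L ^ 2)) * ‖latticePoint m‖ ^ 2) := by
      positivity
    rcases eq_or_ne m 0 with rfl | hm
    · rw [latticeOsc_zero, if_neg fun h => (hmem _ h).1 rfl]
      linarith
    have hr2 : 0 < ‖latticePoint m‖ ^ 2 := by
      have := one_le_norm_latticePoint hm
      positivity
    rcases le_or_gt (‖latticePoint m‖ ^ 2) (K * L ^ 2) with hle | hgt
    · have hc := hcos m hm hle
      split_ifs with hmB
      · have h2 := (hmem m hmB).2
        have hpow : w / 2 ≤ ‖latticePoint m‖ ^ (-(3 / 2) : ℝ) := by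
          rw [hrpow]
          refine le_trans ?_ (rpow_le_rpow_of_nonpos hr2 h2 (by norm_num))
          rw [mul_rpow (by norm_num) hLsq.le, ← hw, div_eq_inv_mul, ← rpow_neg_one]
          gcongr <;> norm_num
        have hexp : exp (-(2 * π)) ≤ exp (-(π / L ^ 2) * ‖latticePoint m‖ ^ 2) := by
          rw [exp_le_exp, neg_mul, neg_le_neg_iff, div_mul_eq_mul_div, div_le_iff₀ hLsq]
          nlinarith [pi_pos]
        have : w * exp (-(2 * π)) / 4 ≤ latticeOsc (L ^ 2) T m := by
          calc _ = w / 2 * exp (-(2 * π)) * (1 / 2) := by ring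
            _ ≤ _ := by
              rw [latticeOsc]
              gcongr
        linarith
      · have : 0 ≤ latticeOsc (L ^ 2) T m :=
          mul_nonneg (by positivity) (by linarith)
        linarith
    · have hmB : m ∉ B := fun h => by
        have := (hmem m h).2
        nlinarith
      rw [if_neg hmB, zero_sub]
      refine neg_le_of_abs_le ?_
      rw [latticeOsc, abs_mul, abs_mul, abs_of_pos (exp_pos _), abs_of_nonneg (by positivity)]
      refine (mul_le_of_le_one_right (by positivity) (abs_cos_le_one _)).trans ?_
      rw [mul_assoc, ← Real.exp_add]
      have hpow : ‖latticePoint m‖ ^ (-(3 / 2) : ℝ) ≤ w := by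
        rw [hrpow]
        exact rpow_le_rpow_of_nonpos hLsq (by nlinarith) (by norm_num)
      have hexp : -(π / L ^ 2) * ‖latticePoint m‖ ^ 2 ≤
          -(π / 2 * K) + -(π / (2 * L ^ 2)) * ‖latticePoint m‖ ^ 2 := by
        have : π / 2 * K ≤ π / (2 * L ^ 2) * ‖latticePoint m‖ ^ 2 := by
          rw [div_mul_eq_mul_div, div_mul_eq_mul_div, div_le_div_iff₀ (by norm_num) (by positivity)]
          nlinarith [mul_le_mul_of_nonneg_left hgt.le pi_pos.le]
        have h2 : π / L ^ 2 = 2 * (π / (2 * L ^ 2)) := by field_simp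
        rw [h2]
        linarith
      gcongr

lemma rpow_quarter_mul_log_le {x T : ℝ} (hx : 1 ≤ x) (hT : 0 < T) (hlog : 1 ≤ log (T ^ 2)) :
    x ^ ((1 : ℝ) / 4) * log x ^ ((1 : ℝ) / 4) ≤
      √T * log (T ^ 2) ^ ((1 : ℝ) / 4) * (1 + x / T ^ 2) := by
  have hx0 : 0 < x := by linarith
  have hT2 : 0 < T ^ 2 := by positivity
  set u := x / T ^ 2 with hu
  have hu0 : 0 < u := by positivity
  have hxu : x = T ^ 2 * u := by
    rw [hu]
    field_simp
  have hlogx : log x ≤ log (T ^ 2) * (1 + u) := by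
    rw [hxu, log_mul hT2.ne' hu0.ne']
    nlinarith [log_le_sub_one_of_pos hu0]
  have hsq : (T ^ 2) ^ ((1 : ℝ) / 4) = √T := by
    rw [sqrt_eq_rpow, ← rpow_natCast, ← rpow_mul hT.le]
    norm_num
  have hroot : (1 + u) ^ ((1 : ℝ) / 4) * (1 + u) ^ ((1 : ℝ) / 4) ≤ 1 + u := by
    rw [← rpow_add (by positivity)]
    exact rpow_le_self_of_one_le (by linarith) (by norm_num)
  calc x ^ ((1 : ℝ) / 4) * log x ^ ((1 : ℝ) / 4)
      ≤ (T ^ 2 * (1 + u)) ^ ((1 : ℝ) / 4) * (log (T ^ 2) * (1 + u)) ^ ((1 : ℝ) / 4) := by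
        have := log_nonneg hx
        gcongr
        rw [hxu]
        nlinarith
    _ = √T * log (T ^ 2) ^ ((1 : ℝ) / 4) *
        ((1 + u) ^ ((1 : ℝ) / 4) * (1 + u) ^ ((1 : ℝ) / 4)) := by
      rw [mul_rpow hT2.le (by positivity), mul_rpow (by linarith) (by positivity), hsq]
      ring
    _ ≤ _ := by gcongr

lemma log_sq_radius_le {K L : ℕ} (hK : 0 < K) (hL : 0 < L) {T : ℝ} (hT : 0 < T)
    (hTL : T ≤ L ^ 2 * 24 ^ (K * L ^ 2 + 1)) : log (T ^ 2) ≤ 96 * K * L ^ 2 := by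
  have hK1 : (1 : ℝ) ≤ K := by exact_mod_cast hK
  have hL1 : (1 : ℝ) ≤ L := by exact_mod_cast hL
  have h1 := log_le_log hT hTL
  rw [log_mul (by positivity) (by positivity), log_pow, log_pow] at h1
  have h2 := log_le_sub_one_of_pos (by linarith : (0 : ℝ) < L)
  have h3 := log_le_sub_one_of_pos (by norm_num : (0 : ℝ) < 24)
  have hKL : (1 : ℝ) ≤ K * L ^ 2 := by nlinarith [one_le_pow₀ hL1 (n := 2)]
  rw [log_pow]
  push_cast at h1 ⊢
  nlinarith

theorem latticeP_omega_minus_log :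
    ∃ c : ℝ, 0 < c ∧ ∃ᶠ x : ℝ in atTop,
      latticeP x ≤ -(c * (x ^ ((1 : ℝ) / 4) * log x ^ ((1 : ℝ) / 4))) := by
  obtain ⟨K, c, hK, hc, hosc⟩ := exists_le_tsum_latticeOsc
  obtain ⟨C, hC, happrox⟩ := exists_smoothDisc_discrepancy_approx
  set S := ∑' m : ℤ × ℤ, exp (-π * ‖latticePoint m‖ ^ 2)
  have hS : 0 < S := tsum_exp_neg_pi_pos
  have hK0 : (0 : ℝ) < K := by exact_mod_cast hK
  set D : ℝ := (96 * K) ^ ((1 : ℝ) / 4) with hD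
  have hD0 : 0 < D := by positivity
  refine ⟨c / (4 * π * D), by positivity, fun hcon => ?_⟩
  simp only [not_le] at hcon
  obtain ⟨X, hX⟩ := eventually_atTop.1 (hcon.and (eventually_ge_atTop 1))
  have hX1 : 1 ≤ X := (hX X le_rfl).2
  obtain ⟨L, hL⟩ := exists_nat_ge (((π * X + C * S + 1) * (2 * π / c)) ^ 2 + 3)
  have hL3 : (3 : ℝ) ≤ L := by nlinarith [sq_nonneg ((π * X + C * S + 1) * (2 * π / c))]
  have hL0 : 0 < L := by
    have : (0 : ℝ) < L := by linarith
    exact_mod_cast this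
  obtain ⟨T, hLT, hTL, hcos⟩ := exists_radius_in_phase K L
  have hT3 : 3 ≤ T := by nlinarith
  have hT : 0 < T := by linarith
  have hlog : 1 ≤ log (T ^ 2) := by
    rw [le_log_iff_exp_le (by positivity)]
    nlinarith [exp_one_lt_d9]
  set l := log (T ^ 2) ^ ((1 : ℝ) / 4)
  have hl0 : 0 < l := by positivity
  have hl : l ≤ D * √L := by
    refine (rpow_le_rpow (by linarith) (log_sq_radius_le hK hL0 hT hTL) (by norm_num)).trans ?_
    rw [mul_rpow (by positivity) (by positivity), ← hD, ← rpow_natCast,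
      ← rpow_mul (by positivity), sqrt_eq_rpow]
    norm_num
  set e := c / (4 * π * D) with he
  have he0 : 0 < e := by positivity
  have hlower := le_smoothDisc_discrepancy (a := L ^ 2) (T := T) (α := π * X + e * (√T * l))
    (β := e * (√T * l) / T ^ 2) (by positivity) hT.le (by positivity) fun x hx => by
      have h0 : 0 ≤ e * (√T * l) / T ^ 2 * x := by positivity
      rcases le_total X x with h | h
      · have h1 := (hX x h).1.le
        have h2 := mul_le_mul_of_nonneg_left
          (rpow_quarter_mul_log_le (hX1.trans h) hT hlog) he0.le
        have h3 : 0 ≤ π * X := by positivity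
        have h4 : e * (√T * l * (1 + x / T ^ 2)) =
            e * (√T * l) + e * (√T * l) / T ^ 2 * x := by ring
        linarith
      · have h1 : (0 : ℝ) ≤ latticeA x := Nat.cast_nonneg _
        have h2 : π * x ≤ π * X := by gcongr
        have h3 : 0 ≤ e * (√T * l) := by positivity
        rw [latticeP]
        linarith
  rw [div_mul_cancel₀ _ (by positivity)] at hlower
  have hupper := (abs_le.1 (happrox (L ^ 2) T (by positivity) hT)).2
  have h1 : √T / π * (c * √L) ≤ √T / π * ∑' m, latticeOsc (L ^ 2) T m :=
    mul_le_mul_of_nonneg_left (hosc L hL0 T hcos) (by positivity)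
  have hsT : 1 ≤ √T := one_le_sqrt.2 (by linarith)
  have h2 : C / √T * ∑' m : ℤ × ℤ, exp (-(π / L ^ 2) * ‖latticePoint m‖ ^ 2) ≤ C * S * √T := by
    calc _ ≤ C / √T * (T * S) := by
          gcongr
          exact (tsum_exp_neg_latticePoint_le (by nlinarith)).trans (by gcongr)
      _ = C * S * (T / √T) := by ring
      _ = _ := by rw [div_sqrt]
  have h3 : e * (√T * l) ≤ √T * (c / (4 * π) * √L) := by
    calc _ ≤ e * (√T * (D * √L)) := by gcongr
      _ = _ := by
        rw [he]
        field_simp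
  have h4 : π * X + C * S + 1 ≤ c / (2 * π) * √L := by
    have hsL : (π * X + C * S + 1) * (2 * π / c) ≤ √L := le_sqrt_of_sq_le (by linarith)
    have := mul_le_mul_of_nonneg_left hsL (by positivity : 0 ≤ c / (2 * π))
    calc _ = c / (2 * π) * ((π * X + C * S + 1) * (2 * π / c)) := by field_simp
      _ ≤ _ := this
  have h5 := mul_le_mul_of_nonneg_left h4 (sqrt_nonneg T)
  have h6 : √T / π * (c * √L) = √T * (c / (2 * π) * √L) + 2 * (√T * (c / (4 * π) * √L)) := by
    field_simp
    ring
  have h7 : π * X ≤ √T * (π * X) := le_mul_of_one_le_left (by positivity) hsT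
  linarith

theorem latticeP_omega_minus :
    ∃ c : ℝ, 0 < c ∧ ∃ᶠ x : ℝ in atTop, latticeP x ≤ -(c * x ^ ((1 : ℝ) / 4)) := by
  obtain ⟨c, hc, h⟩ := latticeP_omega_minus_log
  refine ⟨c, hc, (h.and_eventually (eventually_ge_atTop (exp 1))).mono fun x hx => ?_⟩
  have hx0 : 0 < x := (exp_pos 1).trans_le hx.2
  have hlog : 1 ≤ log x := (le_log_iff_exp_le hx0).2 hx.2
  refine hx.1.trans (neg_le_neg (mul_le_mul_of_nonneg_left ?_ hc.le))
  exact le_mul_of_one_le_right (by positivity) (one_le_rpow hlog (by norm_num))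

theorem hardy_omega_results_circle :
    (∃ c : ℝ, 0 < c ∧ ∃ᶠ x : ℝ in atTop, c * x ^ ((1 : ℝ) / 4) ≤ latticeP x) ∧
    (∃ c : ℝ, 0 < c ∧ ∃ᶠ x : ℝ in atTop, latticeP x ≤ -(c * x ^ ((1 : ℝ) / 4))) ∧
    (∃ c : ℝ, 0 < c ∧ ∃ᶠ x : ℝ in atTop,
      latticeP x ≤ -(c * (x ^ ((1 : ℝ) / 4) * Real.log x ^ ((1 : ℝ) / 4)))) :=
  ⟨latticeP_omega_plus, latticeP_omega_minus, latticeP_omega_minus_log⟩
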